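/- The asymptotic densities of 𝔑_2, 𝔑_6, 𝔑_{42}, and 𝔑_{1806} exist and satisfy 0.583874 < δ(𝔑_2) < 0.584604, 0.70405 < δ(𝔑_6) < 0.707659, 0.78215 < δ(𝔑_{42}) < 0.79399, and 0.7747 < δ(𝔑_{1806}) < 0.812570. -/

import Mathlib

/-- The power sum `S m k = 1^m + 2^m + ⋯ + k^m`. -/
def S (m k : ℕ) : ℕ := ∑ i ∈ Finset.Icc 1 k, i ^ m

/-- The set `𝔑_Q` of positive integers `n` with `S_{Qn}(Qn) ≡ n (mod Qn)`. -/
def Nset (Q : ℕ) : Set ℕ := {n | 0 < n ∧ S (Q * n) (Q * n) ≡ n [MOD Q * n]}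

/-- A set `A` of positive integers has asymptotic density `δ` if
`card (A ∩ [1, N]) / N → δ` as `N → ∞`. -/
def HasDensity (A : Set ℕ) (δ : ℝ) : Prop :=
  Filter.Tendsto (fun N : ℕ => ((A ∩ Set.Icc 1 N).ncard : ℝ) / N)
    Filter.atTop (nhds δ)

theorem sum_range_eq_sum_zmod {M : Type*} [AddCommMonoid M] (N : ℕ) [NeZero N] (f : ZMod N → M) :
    ∑ i ∈ Finset.range N, f i = ∑ x : ZMod N, f x := by
  obtain ⟨n, rfl⟩ := Nat.exists_eq_succ_of_ne_zero (NeZero.ne N)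
  rw [Finset.sum_range]
  exact Finset.sum_congr rfl fun x _ => by
    congr 1
    exact Fin.cast_val_eq_self x

theorem sum_range_mul_eq_nsmul {M : Type*} [AddCommMonoid M] (N : ℕ) [NeZero N] (f : ZMod N → M)
    (c : ℕ) : ∑ i ∈ Finset.range (N * c), f i = c • ∑ x : ZMod N, f x := by
  induction c with
  | zero => simp
  | succ c ih =>
    rw [mul_add_one, Finset.sum_range_add, ih, succ_nsmul]
    congr 1
    rw [← sum_range_eq_sum_zmod]
    simp

theorem cast_S_eq {m N : ℕ} [NeZero N] (hm : 0 < m) (h : N ∣ m) :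
    (S m m : ZMod N) = (m / N : ℕ) * ∑ x : ZMod N, x ^ m := by
  have hm0 : ((m : ZMod N)) = 0 := (ZMod.natCast_eq_zero_iff _ _).2 h
  have h1 : (S m m : ZMod N) = ∑ i ∈ Finset.range m, (i : ZMod N) ^ m := by
    have h2 := Finset.sum_range_succ (fun i : ℕ => (i : ZMod N) ^ m) m
    rw [hm0, zero_pow hm.ne', add_zero] at h2
    rw [← h2, S, Finset.range_eq_Ico, Finset.sum_eq_sum_Ico_succ_bot (by omega)]
    simp [hm.ne', Finset.Ico_add_one_right_eq_Icc]
  rw [h1]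
  obtain ⟨c, rfl⟩ := h
  rw [Nat.mul_div_cancel_left _ (Nat.pos_of_ne_zero (NeZero.ne N)), ← nsmul_eq_mul]
  exact sum_range_mul_eq_nsmul N (fun x => x ^ (N * c)) c

theorem sum_zmod_pow_eq_sum_units {p k m : ℕ} [Fact p.Prime] (hk : k ≤ m) :
    ∑ x : ZMod (p ^ k), x ^ m = ∑ u : (ZMod (p ^ k))ˣ, (u : ZMod (p ^ k)) ^ m := by
  classical
  have h : ∑ u : (ZMod (p ^ k))ˣ, (u : ZMod (p ^ k)) ^ m
      = ∑ x ∈ Finset.univ.image (fun u : (ZMod (p ^ k))ˣ => (u : ZMod (p ^ k))), x ^ m :=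
    (Finset.sum_image fun a _ b _ hab => Units.ext hab).symm
  rw [h]
  symm
  refine Finset.sum_subset (Finset.subset_univ _) fun x _ hx => ?_
  have hx : ¬ IsUnit x := fun ⟨u, hu⟩ => hx (by simp only [Finset.mem_image]; exact ⟨u, Finset.mem_univ _, hu⟩)
  rw [← ZMod.natCast_zmod_val x, ZMod.isUnit_iff_coprime] at hx
  rw [← ZMod.natCast_zmod_val x, ← Nat.cast_pow, ZMod.natCast_eq_zero_iff]
  have hp : p.Prime := Fact.out
  have hd : p ∣ x.val := by
    by_contra hc
    exact hx (Nat.Coprime.pow_right k ((hp.coprime_iff_not_dvd.2 hc).symm))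
  exact (pow_dvd_pow p hk).trans (pow_dvd_pow_of_dvd hd m)

theorem pow_dvd_S_of_not_dvd {p k m : ℕ} (hp : p.Prime) (hm : 0 < m) (h : p ^ k ∣ m)
    (hpm : ¬ p - 1 ∣ m) : p ^ k ∣ S m m := by
  have := Fact.mk hp
  have hk : k ≤ m := (Nat.lt_pow_self hp.one_lt).le.trans (Nat.le_of_dvd hm h)
  rw [← ZMod.natCast_eq_zero_iff, cast_S_eq hm h, sum_zmod_pow_eq_sum_units hk]
  have hex : ∃ g : (ZMod p)ˣ, g ^ m ≠ 1 := by
    by_contra hc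
    push Not at hc
    have := (FiniteField.forall_pow_eq_one_iff (ZMod p) m).1 hc
    rw [Fintype.card_eq_nat_card, Nat.card_zmod] at this
    exact hpm this
  obtain ⟨g, hg⟩ := hex
  have hgp : ¬ p ∣ (g : ZMod p).val := by
    rw [← ZMod.natCast_eq_zero_iff, ZMod.natCast_zmod_val]
    exact g.ne_zero
  have hcop : Nat.Coprime (g : ZMod p).val (p ^ k) :=
    Nat.Coprime.pow_right k ((hp.coprime_iff_not_dvd.2 hgp).symm)
  set v := ZMod.unitOfCoprime _ hcop with hv
  have hvv : (v : ZMod (p ^ k)) = ((g : ZMod p).val : ℕ) := ZMod.coe_unitOfCoprime _ hcop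
  set T := ∑ u : (ZMod (p ^ k))ˣ, (u : ZMod (p ^ k)) ^ m with hT
  have h1 : (v : ZMod (p ^ k)) ^ m * T = T := by
    rw [hT, Finset.mul_sum]
    refine Fintype.sum_equiv (Equiv.mulLeft v) _ _ fun u => ?_
    simp [mul_pow]
  have h2 : IsUnit ((v : ZMod (p ^ k)) ^ m - 1) := by
    have h3 : 1 ≤ (g : ZMod p).val ^ m :=
      Nat.one_le_iff_ne_zero.2 (pow_ne_zero _ fun h0 => hgp (h0 ▸ dvd_zero p))
    have h4 : (v : ZMod (p ^ k)) ^ m - 1 = (((g : ZMod p).val ^ m - 1 : ℕ) : ZMod (p ^ k)) := by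
      rw [hvv, Nat.cast_sub h3]; simp
    rw [h4, ZMod.isUnit_iff_coprime]
    refine Nat.Coprime.pow_right k ((hp.coprime_iff_not_dvd.2 fun hd => hg ?_).symm)
    rw [← ZMod.natCast_eq_zero_iff, Nat.cast_sub h3] at hd
    ext
    simpa [sub_eq_zero] using hd
  have h5 : ((v : ZMod (p ^ k)) ^ m - 1) * T = 0 := by rw [sub_mul, h1]; ring
  rw [(h2.mul_right_eq_zero).1 h5, mul_zero]

theorem pow_dvd_S_add {p k m : ℕ} (hp : p.Prime) (hk0 : k ≠ 0) (hm : 0 < m) (h : p ^ k ∣ m)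
    (hpm : p - 1 ∣ m) : p ^ k ∣ S m m + m / p := by
  have := Fact.mk hp
  have hk : k ≤ m := (Nat.lt_pow_self hp.one_lt).le.trans (Nat.le_of_dvd hm h)
  rw [← ZMod.natCast_eq_zero_iff, Nat.cast_add, cast_S_eq hm h, sum_zmod_pow_eq_sum_units hk]
  obtain ⟨j, rfl⟩ := Nat.exists_eq_add_one_of_ne_zero hk0
  have htot : Nat.totient (p ^ (j + 1)) ∣ m := by
    rw [Nat.totient_prime_pow_succ hp]
    refine Nat.Coprime.mul_dvd_of_dvd_of_dvd ?_ ((pow_dvd_pow p (Nat.le_succ j)).trans h) hpm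
    refine Nat.Coprime.pow_left j ?_
    exact (hp.coprime_iff_not_dvd.2 fun hd => by
      have := Nat.le_of_dvd (Nat.sub_pos_of_lt hp.one_lt) hd
      have := hp.two_le
      omega)
  have h1 : ∀ u : (ZMod (p ^ (j + 1)))ˣ, (u : ZMod (p ^ (j + 1))) ^ m = 1 := fun u => by
    obtain ⟨c, hc⟩ := htot
    rw [hc, pow_mul, ← Units.val_pow_eq_pow_val, ZMod.pow_totient]
    simp
  simp only [h1, Finset.sum_const, Finset.card_univ, ZMod.card_units_eq_totient]
  obtain ⟨c, rfl⟩ := h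
  have hpp : 0 < p := hp.pos
  have h3 : p ^ (j + 1) * c / p = p ^ j * c := by
    rw [pow_succ, mul_assoc, mul_comm p c, ← mul_assoc, Nat.mul_div_cancel _ hpp]
  have h4 : p - 1 + 1 = p := Nat.sub_add_cancel hp.one_le
  rw [h3, Nat.mul_div_cancel_left _ (pow_pos hpp _), Nat.totient_prime_pow_succ hp, nsmul_eq_mul,
    mul_one, ← Nat.cast_mul, ← Nat.cast_add, ZMod.natCast_eq_zero_iff]
  refine ⟨c, ?_⟩
  calc c * (p ^ j * (p - 1)) + p ^ j * c = p ^ j * (p - 1 + 1) * c := by ring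
    _ = _ := by rw [h4]; ring

/-- The smallest `d` with `d ∣ n ↔ p ∣ n ∧ p - 1 ∣ Q * n`. -/
def gen (Q p : ℕ) : ℕ := p * ((p - 1) / Nat.gcd (p - 1) Q)

theorem gen_dvd_iff {Q p n : ℕ} (hp : p.Prime) : gen Q p ∣ n ↔ p ∣ n ∧ p - 1 ∣ Q * n := by
  have hp1 : 0 < p - 1 := Nat.sub_pos_of_lt hp.one_lt
  have hg : 0 < Nat.gcd (p - 1) Q := Nat.gcd_pos_of_pos_left _ hp1
  have h1 : p - 1 ∣ Q * n ↔ (p - 1) / Nat.gcd (p - 1) Q ∣ n := by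
    constructor
    · intro h
      refine (Nat.coprime_div_gcd_div_gcd hg).dvd_of_dvd_mul_left (m := Q / Nat.gcd (p - 1) Q) ?_
      obtain ⟨c, hc⟩ := h
      refine ⟨c, Nat.eq_of_mul_eq_mul_left hg ?_⟩
      rw [← mul_assoc, Nat.mul_div_cancel' (Nat.gcd_dvd_right _ _), ← mul_assoc,
        Nat.mul_div_cancel' (Nat.gcd_dvd_left _ _), hc]
    · intro h
      have := mul_dvd_mul (Nat.gcd_dvd_right (p - 1) Q) h
      rwa [Nat.mul_div_cancel' (Nat.gcd_dvd_left _ _)] at this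
  rw [h1, gen]
  refine ⟨fun h => ⟨dvd_of_mul_right_dvd h, dvd_of_mul_left_dvd h⟩, fun h =>
    Nat.Coprime.mul_dvd_of_dvd_of_dvd ?_ h.1 h.2⟩
  refine hp.coprime_iff_not_dvd.2 fun hd => ?_
  have := Nat.le_of_dvd hp1 (hd.trans (Nat.div_dvd_of_dvd (Nat.gcd_dvd_left _ _)))
  omega

theorem mem_Nset_iff {Q n : ℕ} (hQ : 0 < Q)
    (H : ∀ p, p.Prime → p ∣ Q → p - 1 ∣ Q ∧ p ∣ Q / p + 1) :
    n ∈ Nset Q ↔ 0 < n ∧ ∀ p, p.Prime → ¬ p ∣ Q → ¬ gen Q p ∣ n := by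
  refine and_congr_right fun hn => ?_
  have hm : 0 < Q * n := Nat.mul_pos hQ hn
  constructor
  · intro h p hp hpQ hd
    obtain ⟨hpn, hpm⟩ := (gen_dvd_iff hp).1 hd
    obtain ⟨k, t, hpt, hnt⟩ := Nat.exists_eq_pow_mul_and_not_dvd hn.ne' p hp.ne_one
    have hk : k ≠ 0 := by
      rintro rfl
      exact hpt (by simpa [hnt] using hpn)
    have hkn : p ^ k ∣ n := ⟨t, hnt⟩
    have h1 := pow_dvd_S_add hp hk hm (hkn.mul_left Q) hpm
    have h2 : p ^ k ∣ S (Q * n) (Q * n) :=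
      ((h.of_dvd (hkn.mul_left Q)).dvd_iff dvd_rfl).2 hkn
    have h3 := (Nat.dvd_add_right h2).1 h1
    obtain ⟨j, rfl⟩ := Nat.exists_eq_add_one_of_ne_zero hk
    have h4 : Q * n / p = p ^ j * (Q * t) := by
      rw [hnt]
      refine Nat.div_eq_of_eq_mul_left hp.pos ?_
      ring
    rw [h4, pow_succ] at h3
    have h5 := Nat.dvd_of_mul_dvd_mul_left (pow_pos hp.pos j) h3
    exact (hp.dvd_mul.1 h5).elim hpQ hpt
  · intro h
    have hloc : ∀ p k : ℕ, p.Prime → p ^ k ∣ Q * n →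
        ((p ^ k : ℕ) : ℤ) ∣ (n : ℤ) - (S (Q * n) (Q * n) : ℕ) := by
      intro p k hp hd
      rcases eq_or_ne k 0 with rfl | hk
      · simp
      by_cases hpQ : p ∣ Q
      · obtain ⟨h1, h2⟩ := H p hp hpQ
        have h3 := pow_dvd_S_add hp hk hm hd (h1.mul_right n)
        obtain ⟨q, rfl⟩ := hpQ
        rw [Nat.mul_div_cancel_left _ hp.pos] at h2
        rw [mul_assoc p q n, Nat.mul_div_cancel_left _ hp.pos, ← mul_assoc] at h3
        obtain ⟨j, rfl⟩ := Nat.exists_eq_add_one_of_ne_zero hk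
        have hpq : ¬ p ∣ q := fun hq => hp.not_dvd_one ((Nat.dvd_add_right hq).1 h2)
        have h4 : p ^ j ∣ n := by
          refine Nat.Coprime.dvd_of_dvd_mul_left
            (Nat.Coprime.pow_left j (hp.coprime_iff_not_dvd.2 hpq)) ?_
          rw [pow_succ', mul_assoc] at hd
          exact Nat.dvd_of_mul_dvd_mul_left hp.pos hd
        have h5 : p ^ (j + 1) ∣ n * (q + 1) := by
          rw [pow_succ]
          exact mul_dvd_mul h4 h2
        have h6 := dvd_sub (Int.natCast_dvd_natCast.2 h5) (Int.natCast_dvd_natCast.2 h3)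
        push_cast at h6 ⊢
        have h7 : (n : ℤ) - S (p * q * n) (p * q * n)
            = n * (q + 1) - (S (p * q * n) (p * q * n) + q * n) := by ring
        rw [h7]
        exact h6
      · have h1 : p ^ k ∣ n :=
          (Nat.Coprime.pow_left k (hp.coprime_iff_not_dvd.2 hpQ)).dvd_of_dvd_mul_left hd
        have h2 : ¬ p - 1 ∣ Q * n := fun hc =>
          h p hp hpQ ((gen_dvd_iff hp).2 ⟨(dvd_pow_self p hk).trans h1, hc⟩)
        exact dvd_sub (Int.natCast_dvd_natCast.2 h1)
          (Int.natCast_dvd_natCast.2 (pow_dvd_S_of_not_dvd hp hm hd h2))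
    rw [Nat.modEq_iff_dvd, Int.natCast_dvd, Nat.dvd_iff_prime_pow_dvd_dvd]
    exact fun p k hp hd => Int.natCast_dvd.1 (hloc p k hp hd)

theorem finite_inter_Icc (A : Set ℕ) (N : ℕ) : (A ∩ Set.Icc 1 N).Finite :=
  (Set.finite_Icc 1 N).inter_of_right A

theorem ncard_inter_Icc_mono {A B : Set ℕ} (h : A ⊆ B) (N : ℕ) :
    (A ∩ Set.Icc 1 N).ncard ≤ (B ∩ Set.Icc 1 N).ncard :=
  Set.ncard_le_ncard (Set.inter_subset_inter_left _ h) (finite_inter_Icc B N)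

theorem HasDensity.mono {A B : Set ℕ} {α β : ℝ} (hA : HasDensity A α) (hB : HasDensity B β)
    (h : A ⊆ B) : α ≤ β :=
  le_of_tendsto_of_tendsto' hA hB fun N => by
    exact div_le_div_of_nonneg_right (Nat.cast_le.2 (ncard_inter_Icc_mono h N)) N.cast_nonneg

theorem HasDensity.nonneg {A : Set ℕ} {α : ℝ} (hA : HasDensity A α) : 0 ≤ α :=
  ge_of_tendsto' hA fun N => by positivity

theorem HasDensity.sdiff {A B : Set ℕ} {α β : ℝ} (hA : HasDensity A α) (hB : HasDensity B β)
    (h : B ⊆ A) : HasDensity (A \ B) (α - β) := by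
  refine (Filter.Tendsto.sub hA hB).congr fun N => ?_
  have hI : A \ B ∩ Set.Icc 1 N = (A ∩ Set.Icc 1 N) \ (B ∩ Set.Icc 1 N) := by
    ext n
    simp only [Set.mem_inter_iff, Set.mem_sdiff]
    tauto
  rw [← sub_div, hI, Set.ncard_sdiff (Set.inter_subset_inter_left _ h)
    (finite_inter_Icc B N), Nat.cast_sub (ncard_inter_Icc_mono h N)]

theorem hasDensity_pos : HasDensity {n | 0 < n} 1 := by
  refine tendsto_const_nhds.congr' ?_
  filter_upwards [Filter.eventually_gt_atTop 0] with N hN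
  have h : {n | 0 < n} ∩ Set.Icc 1 N = ((Finset.Icc 1 N : Finset ℕ) : Set ℕ) := by
    ext n
    simp
    omega
  rw [h, Set.ncard_coe_finset, Nat.card_Icc, Nat.add_sub_cancel, div_self]
  exact_mod_cast hN.ne'

theorem ncard_image_mul_inter_Icc (A : Set ℕ) {d : ℕ} (hd : 0 < d) (N : ℕ) :
    ((d * ·) '' A ∩ Set.Icc 1 N).ncard = (A ∩ Set.Icc 1 (N / d)).ncard := by
  rw [← Set.ncard_image_of_injective (A ∩ Set.Icc 1 (N / d)) (mul_right_injective₀ hd.ne')]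
  congr 1
  ext n
  simp only [Set.mem_inter_iff, Set.mem_image, Set.mem_Icc]
  constructor
  · rintro ⟨⟨a, ha, rfl⟩, h1, h2⟩
    exact ⟨a, ⟨ha, Nat.pos_of_mul_pos_left h1, (Nat.le_div_iff_mul_le hd).2 (by linarith)⟩, rfl⟩
  · rintro ⟨a, ⟨ha, h1, h2⟩, rfl⟩
    have := (Nat.le_div_iff_mul_le hd).1 h2
    exact ⟨⟨a, ha, rfl⟩, Nat.mul_pos hd h1, by linarith⟩

theorem tendsto_natDiv_div (d : ℕ) (hd : 0 < d) :
    Filter.Tendsto (fun N : ℕ => ((N / d : ℕ) : ℝ) / N) Filter.atTop (nhds (1 / d)) := by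
  have h := (tendsto_nat_floor_mul_div_atTop (R := ℝ) (a := 1 / d) (by positivity)).comp
    tendsto_natCast_atTop_atTop
  refine h.congr fun N => ?_
  simp only [Function.comp]
  rw [one_div_mul_eq_div, Nat.floor_div_eq_div]

theorem HasDensity.image_mul {A : Set ℕ} {α : ℝ} (hA : HasDensity A α) {d : ℕ} (hd : 0 < d) :
    HasDensity ((d * ·) '' A) (α / d) := by
  have h1 := (hA.comp (Nat.tendsto_div_const_atTop hd.ne')).mul (tendsto_natDiv_div d hd)
  rw [mul_one_div] at h1
  refine h1.congr' ?_
  filter_upwards [Filter.eventually_ge_atTop d] with N hN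
  have h2 : ((N / d : ℕ) : ℝ) ≠ 0 := by exact_mod_cast (Nat.div_pos hN hd).ne'
  simp only [Function.comp]
  rw [ncard_image_mul_inter_Icc A hd, div_mul_div_cancel₀ h2]

/-- The positive integers divisible by no element of `L`. -/
def avoid (L : List ℕ) : Set ℕ := {n | 0 < n ∧ ∀ d ∈ L, ¬ d ∣ n}

/-- The moduli of `L` after division of all integers by `d`. -/
def quot (L : List ℕ) (d : ℕ) : List ℕ := L.map fun e => e / Nat.gcd e d

theorem pos_of_mem_quot {L : List ℕ} (hL : ∀ e ∈ L, 0 < e) {d : ℕ} :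
    ∀ e ∈ quot L d, 0 < e := by
  simp only [quot, List.mem_map]
  rintro _ ⟨e, he, rfl⟩
  exact Nat.div_pos (Nat.gcd_le_left d (hL e he)) (Nat.gcd_pos_of_pos_left _ (hL e he))

theorem div_gcd_dvd_iff {e d n : ℕ} (hd : 0 < d) : e / Nat.gcd e d ∣ n ↔ e ∣ d * n := by
  have hg : 0 < Nat.gcd e d := Nat.gcd_pos_of_pos_right _ hd
  constructor
  · intro h
    have := mul_dvd_mul (Nat.gcd_dvd_right e d) h
    rwa [Nat.mul_div_cancel' (Nat.gcd_dvd_left _ _)] at this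
  · intro h
    refine (Nat.coprime_div_gcd_div_gcd hg).dvd_of_dvd_mul_left (m := d / Nat.gcd e d) ?_
    obtain ⟨c, hc⟩ := h
    refine ⟨c, Nat.eq_of_mul_eq_mul_left hg ?_⟩
    rw [← mul_assoc, Nat.mul_div_cancel' (Nat.gcd_dvd_right _ _), ← mul_assoc,
      Nat.mul_div_cancel' (Nat.gcd_dvd_left _ _), hc]

theorem image_mul_avoid_quot_subset (L : List ℕ) {d : ℕ} (hd : 0 < d) :
    (d * ·) '' avoid (quot L d) ⊆ avoid L := by
  rintro _ ⟨n, ⟨hn, h⟩, rfl⟩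
  refine ⟨Nat.mul_pos hd hn, fun e he hed => h (e / Nat.gcd e d) ?_ ((div_gcd_dvd_iff hd).2 hed)⟩
  exact List.mem_map.2 ⟨e, he, rfl⟩

theorem avoid_cons (L : List ℕ) {d : ℕ} (hd : 0 < d) :
    avoid (d :: L) = avoid L \ (d * ·) '' avoid (quot L d) := by
  ext n
  simp only [avoid, Set.mem_sdiff, Set.mem_ofPred_eq, List.mem_cons, forall_eq_or_imp, Set.mem_image]
  constructor
  · rintro ⟨hn, h1, h2⟩
    exact ⟨⟨hn, h2⟩, fun ⟨a, _, ha⟩ => h1 ⟨a, ha.symm⟩⟩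
  · rintro ⟨⟨hn, h1⟩, h2⟩
    refine ⟨hn, ?_, h1⟩
    rintro ⟨a, rfl⟩
    refine h2 ⟨a, ⟨Nat.pos_of_mul_pos_left hn, fun e he hea => ?_⟩, rfl⟩
    obtain ⟨f, hf, rfl⟩ := List.mem_map.1 he
    exact h1 f hf ((div_gcd_dvd_iff hd).1 hea)

theorem HasDensity.avoid_cons {L : List ℕ} {d : ℕ} (hd : 0 < d) {α β : ℝ}
    (h1 : HasDensity (avoid L) α) (h2 : HasDensity (avoid (quot L d)) β) :
    HasDensity (avoid (d :: L)) (α - β / d) := by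
  rw [_root_.avoid_cons L hd]
  exact h1.sdiff (h2.image_mul hd) (image_mul_avoid_quot_subset L hd)

theorem hasDensity_avoid_nil : HasDensity (avoid []) 1 := by
  simpa [avoid] using hasDensity_pos

theorem exists_hasDensity_avoid (L : List ℕ) (hL : ∀ e ∈ L, 0 < e) :
    ∃ α, HasDensity (avoid L) α := by
  induction hn : L.length generalizing L with
  | zero => exact ⟨1, by rw [List.length_eq_zero_iff.1 hn]; exact hasDensity_avoid_nil⟩
  | succ n ih =>
    obtain ⟨d, L, rfl⟩ := List.exists_cons_of_length_eq_add_one hn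
    have hL' : ∀ e ∈ L, 0 < e := fun e he => hL e (List.mem_cons_of_mem _ he)
    have hlen : L.length = n := by simpa using hn
    obtain ⟨α, hα⟩ := ih L hL' hlen
    obtain ⟨β, hβ⟩ := ih (quot L d) (pos_of_mem_quot hL') (by simpa [quot] using hlen)
    exact ⟨_, hα.avoid_cons (hL d List.mem_cons_self) hβ⟩

/-- Remove from `L` elements that are multiples of later remaining elements. -/
def prune : List ℕ → List ℕ
  | [] => []
  | d :: L => if (prune L).any (fun e => d % e == 0) then prune L else d :: prune L

theorem prune_subset (L : List ℕ) : ∀ e ∈ prune L, e ∈ L := by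
  induction L with
  | nil => simp [prune]
  | cons d L ih =>
    intro e he
    rw [prune] at he
    split at he
    · exact List.mem_cons_of_mem _ (ih e he)
    · rcases List.mem_cons.1 he with rfl | he
      · exact List.mem_cons_self
      · exact List.mem_cons_of_mem _ (ih e he)

theorem avoid_prune (L : List ℕ) : avoid (prune L) = avoid L := by
  ext n
  refine and_congr_right fun _ => ⟨fun h => ?_, fun h d hd => h d (prune_subset L d hd)⟩
  induction L with
  | nil => simp
  | cons d L ih =>
    rw [prune] at h
    split at h
    · next hany =>
      obtain ⟨e, he, hed⟩ := List.any_eq_true.1 hany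
      have hed : e ∣ d := Nat.dvd_of_mod_eq_zero (by simpa using hed)
      intro x hx
      rcases List.mem_cons.1 hx with rfl | hx
      · exact fun hd => h e he (hed.trans hd)
      · exact ih h x hx
    · intro x hx
      rcases List.mem_cons.1 hx with rfl | hx
      · exact h x List.mem_cons_self
      · exact ih (fun d hd => h d (List.mem_cons_of_mem _ hd)) x hx

/-- An upper (`b = true`) or lower (`b = false`) bound for `10 ^ 12` times the density of `avoid L`;
branches of weight less than `1 / w` are estimated trivially. -/
def avoidBound : Bool → ℕ → List ℕ → ℕ → ℕ
  | b, 0, _, _ => if b then 10 ^ 12 else 0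
  | _, _ + 1, [], _ => 10 ^ 12
  | b, n + 1, d :: L, w =>
    if (d :: L).any (fun e => e == 1) then 0
    else if w == 0 then (if b then 10 ^ 12 else 0)
    else if b then avoidBound b n L w - avoidBound false n (prune (quot L d)) (w / d) / d
    else avoidBound b n L w - (avoidBound true n (prune (quot L d)) (w / d) / d + 1)

theorem avoidBound_spec (n : ℕ) (L : List ℕ) (hL : ∀ e ∈ L, 0 < e) (w : ℕ) {α : ℝ}
    (hα : HasDensity (avoid L) α) :
    (avoidBound false n L w : ℝ) ≤ 10 ^ 12 * α ∧ 10 ^ 12 * α ≤ avoidBound true n L w := by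
  have h0 : 0 ≤ α := hα.nonneg
  have h1 : α ≤ 1 := hα.mono hasDensity_pos fun n hn => hn.1
  induction n generalizing L w α with
  | zero => simp [avoidBound]; constructor <;> linarith
  | succ n ih =>
    cases L with
    | nil =>
      rw [tendsto_nhds_unique hα hasDensity_avoid_nil]
      norm_num [avoidBound]
    | cons d L =>
      have hL' : ∀ e ∈ L, 0 < e := fun e he => hL e (List.mem_cons_of_mem _ he)
      have hd := hL d List.mem_cons_self
      have hdR : (0 : ℝ) < d := by exact_mod_cast hd
      by_cases hone : (d :: L).any (fun e => e == 1)
      · have hempty : avoid (d :: L) = ∅ := by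
          obtain ⟨e, he, he1⟩ := List.any_eq_true.1 hone
          have he1 : e = 1 := by simpa using he1
          refine Set.eq_empty_of_forall_notMem fun n hn => hn.2 e he (he1 ▸ one_dvd n)
        have hz : α = 0 := by
          refine tendsto_nhds_unique hα ?_
          simp only [hempty]
          simp
        simp only [avoidBound, hone, hz]
        simp
      by_cases hw : w = 0
      · simp only [avoidBound, hone, hw]
        simp
        constructor <;> linarith
      obtain ⟨γ, hγ⟩ := exists_hasDensity_avoid L hL'
      obtain ⟨β, hβ⟩ := exists_hasDensity_avoid (quot L d) (pos_of_mem_quot hL')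
      have hαe : α = γ - β / d := tendsto_nhds_unique hα (hγ.avoid_cons hd hβ)
      have hγ' := ih L hL' w hγ hγ.nonneg (hγ.mono hasDensity_pos fun n hn => hn.1)
      have hβ' := ih (prune (quot L d)) (fun e he => pos_of_mem_quot hL' e (prune_subset _ e he))
        (w / d) (by rwa [avoid_prune]) hβ.nonneg (hβ.mono hasDensity_pos fun n hn => hn.1)
      have hwb : (w == 0) = false := by simpa using hw
      have e1 : avoidBound false (n + 1) (d :: L) w = avoidBound false n L w -
          (avoidBound true n (prune (quot L d)) (w / d) / d + 1) := by
        simp only [avoidBound, hone, hwb]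
        simp
      have e2 : avoidBound true (n + 1) (d :: L) w = avoidBound true n L w -
          avoidBound false n (prune (quot L d)) (w / d) / d := by
        simp only [avoidBound, hone, hwb]
        simp
      rw [e1, e2]
      generalize avoidBound true n (prune (quot L d)) (w / d) = B at *
      generalize avoidBound false n (prune (quot L d)) (w / d) = B' at *
      generalize avoidBound true n L w = G at *
      generalize avoidBound false n L w = G' at *
      constructor
      · rcases le_total (B / d + 1) G' with hle | hle
        · have h2 : (B : ℝ) / d ≤ (B / d : ℕ) + 1 := by
            rw [div_le_iff₀ hdR]
            exact_mod_cast (Nat.lt_mul_of_div_lt (Nat.lt_succ_self (B / d)) hd).le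
          have h3 : 10 ^ 12 * β / d ≤ B / d := by gcongr; exact hβ'.2
          rw [Nat.cast_sub hle, hαe, Nat.cast_add, Nat.cast_one, mul_sub, ← mul_div_assoc]
          linarith [hγ'.1]
        · rw [Nat.sub_eq_zero_of_le hle]
          simp
          exact h0
      · have h2 : ((B' / d : ℕ) : ℝ) ≤ B' / d := Nat.cast_div_le
        have h3 : (B' : ℝ) / d ≤ 10 ^ 12 * β / d := by gcongr; exact hβ'.1
        have h4 : (G : ℝ) - (B' / d : ℕ) ≤ (G - B' / d : ℕ) := by
          rw [sub_le_iff_le_add]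
          exact_mod_cast Nat.le_add_of_sub_le le_rfl
        refine le_trans ?_ h4
        rw [hαe, mul_sub, ← mul_div_assoc]
        linarith [hγ'.2]

theorem one_div_gen_le {Q j : ℕ} (hQ : 0 < Q) (hj : 2 ≤ j) :
    (1 : ℝ) / gen Q (2 * j + 1) ≤ Q / 4 * (1 / ((j : ℝ) - 1) - 1 / j) := by
  have hg : 0 < Nat.gcd (2 * j) Q := Nat.gcd_pos_of_pos_right _ hQ
  have h1 : (2 * j + 1) * (2 * j) ≤ gen Q (2 * j + 1) * Q := by
    rw [gen, Nat.add_sub_cancel, mul_assoc]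
    refine Nat.mul_le_mul_left _ ?_
    calc 2 * j = 2 * j / Nat.gcd (2 * j) Q * Nat.gcd (2 * j) Q :=
          (Nat.div_mul_cancel (Nat.gcd_dvd_left _ _)).symm
      _ ≤ _ := Nat.mul_le_mul_left _ (Nat.gcd_le_right _ hQ)
  have h2 : ((2 : ℝ) * j + 1) * (2 * j) ≤ gen Q (2 * j + 1) * Q := by exact_mod_cast h1
  have hj' : (2 : ℝ) ≤ j := by exact_mod_cast hj
  have hQ' : (0 : ℝ) < Q := by exact_mod_cast hQ
  have hgen : (0 : ℝ) < gen Q (2 * j + 1) := by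
    by_contra hc
    nlinarith
  have h3 : (Q : ℝ) / 4 * (1 / ((j : ℝ) - 1) - 1 / j) = Q / (4 * (j * (j - 1))) := by
    have : (j : ℝ) - 1 ≠ 0 := by linarith
    field_simp
    ring
  rw [h3, div_le_div_iff₀ hgen (by nlinarith)]
  nlinarith

theorem sum_telescope_le {J : ℕ} (hJ : 2 ≤ J) (N : ℕ) :
    ∑ i ∈ Finset.range N, (1 / (((J + i : ℕ) : ℝ) - 1) - 1 / ((J + i : ℕ) : ℝ))
      ≤ 1 / ((J : ℝ) - 1) := by
  have h := Finset.sum_range_sub' (fun i : ℕ => 1 / (((J + i : ℕ) : ℝ) - 1)) N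
  have hJ' : (2 : ℝ) ≤ J := by exact_mod_cast hJ
  calc _ = ∑ i ∈ Finset.range N, (1 / (((J + i : ℕ) : ℝ) - 1) - 1 / (((J + (i + 1) : ℕ) : ℝ) - 1)) := by
        refine Finset.sum_congr rfl fun i _ => ?_
        congr 2
        push_cast
        ring
    _ = _ := h
    _ ≤ _ := by
      have : 0 ≤ 1 / (((J + N : ℕ) : ℝ) - 1) := by
        push_cast
        have : (0 : ℝ) ≤ N := N.cast_nonneg
        exact div_nonneg zero_le_one (by linarith)
      simpa using this

theorem ncard_avoid_le {Q J : ℕ} {L : List ℕ} {A : Set ℕ} (hQ : 0 < Q) (hQ2 : 2 ∣ Q)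
    (hA : ∀ n, n ∈ A ↔ 0 < n ∧ ∀ p, p.Prime → ¬ p ∣ Q → ¬ gen Q p ∣ n) (hJ : 2 ≤ J)
    (t : ℕ → Bool)
    (ht : ∀ j < J, (2 * j + 1).Prime → ¬ (2 * j + 1) ∣ Q →
      (∀ e ∈ L, ¬ e ∣ gen Q (2 * j + 1)) → t j) (N : ℕ) :
    ((avoid L ∩ Set.Icc 1 N).ncard : ℝ) ≤ (A ∩ Set.Icc 1 N).ncard +
      N * (∑ j ∈ Finset.range J, (if t j then (1 : ℝ) / gen Q (2 * j + 1) else 0)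
        + Q / (4 * ((J : ℝ) - 1))) := by
  classical
  set U : ℕ → Finset ℕ := fun j =>
    if j < J ∧ ¬ t j then ∅ else (Finset.Ioc 0 N).filter (gen Q (2 * j + 1) ∣ ·) with hU
  have hcov : avoid L ∩ Set.Icc 1 N ⊆
      (A ∩ Set.Icc 1 N) ∪ (((Finset.range (J + N)).biUnion U : Finset ℕ) : Set ℕ) := by
    rintro n ⟨⟨hn, hL⟩, hnN⟩
    by_cases hnA : n ∈ A
    · exact Or.inl ⟨hnA, hnN⟩
    right
    rw [hA] at hnA
    push Not at hnA
    obtain ⟨p, hp, hpQ, hpn⟩ := hnA hn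
    obtain ⟨j, rfl⟩ : ∃ j, p = 2 * j + 1 := by
      refine (hp.eq_two_or_odd').resolve_left ?_
      rintro rfl
      exact hpQ hQ2
    have hle : 2 * j + 1 ≤ n := Nat.le_of_dvd hn ((gen_dvd_iff hp).1 hpn).1
    have hN : n ≤ N := hnN.2
    simp only [Finset.coe_biUnion, Set.mem_iUnion, Finset.mem_coe, Finset.mem_range, hU]
    refine ⟨j, by omega, ?_⟩
    rw [if_neg]
    · simp only [Finset.mem_filter, Finset.mem_Ioc]
      exact ⟨⟨hn, hN⟩, hpn⟩
    · rintro ⟨hj, htj⟩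
      exact htj (ht j hj hp hpQ fun e he hed => hL e he (hed.trans hpn))
  have hcard : (avoid L ∩ Set.Icc 1 N).ncard ≤
      (A ∩ Set.Icc 1 N).ncard + ∑ j ∈ Finset.range (J + N), (U j).card := by
    refine (Set.ncard_le_ncard hcov ((finite_inter_Icc A N).union (Finset.finite_toSet _))).trans ?_
    refine (Set.ncard_union_le _ _).trans ?_
    rw [Set.ncard_coe_finset]
    exact Nat.add_le_add_left Finset.card_biUnion_le _
  have hmul : ∀ d : ℕ, (((Finset.Ioc 0 N).filter (d ∣ ·)).card : ℝ) ≤ N * (1 / d) := fun d => by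
    rw [Nat.Ioc_filter_dvd_card_eq_div, mul_one_div]
    exact Nat.cast_div_le
  have hsmall : ∀ j ∈ Finset.range J,
      ((U j).card : ℝ) ≤ N * (if t j then (1 : ℝ) / gen Q (2 * j + 1) else 0) := by
    intro j hj
    have hj := Finset.mem_range.1 hj
    by_cases htj : t j
    · simpa [hU, htj] using hmul (gen Q (2 * j + 1))
    · simp [hU, htj, hj]
  have hlarge : ∀ i ∈ Finset.range N, ((U (J + i)).card : ℝ) ≤
      N * (Q / 4 * (1 / (((J + i : ℕ) : ℝ) - 1) - 1 / ((J + i : ℕ) : ℝ))) := by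
    intro i _
    have h1 := hmul (gen Q (2 * (J + i) + 1))
    have h2 : ¬ (J + i < J ∧ ¬ t (J + i)) := by omega
    simp only [hU]
    rw [if_neg h2]
    exact h1.trans (mul_le_mul_of_nonneg_left (one_div_gen_le hQ (by omega)) N.cast_nonneg)
  calc ((avoid L ∩ Set.Icc 1 N).ncard : ℝ)
      ≤ (A ∩ Set.Icc 1 N).ncard + ∑ j ∈ Finset.range (J + N), ((U j).card : ℝ) := by
        exact_mod_cast hcard
    _ ≤ _ := by
      rw [Finset.sum_range_add, mul_add, Finset.mul_sum]
      refine add_le_add_right (add_le_add (Finset.sum_le_sum hsmall)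
        ((Finset.sum_le_sum hlarge).trans ?_)) _
      rw [← Finset.mul_sum, ← Finset.mul_sum, ← div_div, div_eq_mul_one_div ((Q : ℝ) / 4)]
      exact mul_le_mul_of_nonneg_left
        (mul_le_mul_of_nonneg_left (sum_telescope_le hJ N) (by positivity)) N.cast_nonneg

theorem HasDensity.sub_le {A B : Set ℕ} {α β ε : ℝ} (hA : HasDensity A α) (hB : HasDensity B β)
    (h : ∀ N : ℕ, ((B ∩ Set.Icc 1 N).ncard : ℝ) ≤ (A ∩ Set.Icc 1 N).ncard + N * ε) :
    β - ε ≤ α := by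
  rw [sub_le_iff_le_add]
  refine le_of_tendsto_of_tendsto hB (Filter.Tendsto.add_const ε hA) ?_
  filter_upwards [Filter.eventually_gt_atTop 0] with N hN
  have hN' : (0 : ℝ) < N := by exact_mod_cast hN
  rw [div_add' _ _ _ hN'.ne']
  refine div_le_div_of_nonneg_right ?_ hN'.le
  rw [mul_comm ε]
  exact h N

theorem exists_hasDensity_of_approx {A : Set ℕ} (B : ℕ → Set ℕ) (β ε : ℕ → ℝ)
    (hB : ∀ k, HasDensity (B k) (β k)) (hAB : ∀ k, A ⊆ B k)
    (h : ∀ k N : ℕ, ((B k ∩ Set.Icc 1 N).ncard : ℝ) ≤ (A ∩ Set.Icc 1 N).ncard + N * ε k)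
    (hε : Filter.Tendsto ε Filter.atTop (nhds 0)) : ∃ δ, HasDensity A δ := by
  refine cauchySeq_tendsto_of_complete (Metric.cauchySeq_iff'.2 fun η hη => ?_)
  obtain ⟨k, hk⟩ := (hε.eventually (gt_mem_nhds (show (0 : ℝ) < η / 4 by positivity))).exists
  obtain ⟨M, hM⟩ := Filter.eventually_atTop.1
    ((Metric.tendsto_nhds.1 (hB k) (η / 4) (by positivity)).and (Filter.eventually_gt_atTop 0))
  have key : ∀ N ≥ M, β k - η / 2 < ((A ∩ Set.Icc 1 N).ncard : ℝ) / N ∧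
      ((A ∩ Set.Icc 1 N).ncard : ℝ) / N < β k + η / 4 := by
    intro N hN
    obtain ⟨h1, h2⟩ := hM N hN
    have hN' : (0 : ℝ) < N := by exact_mod_cast h2
    rw [Real.dist_eq, abs_lt] at h1
    have h3 : ((A ∩ Set.Icc 1 N).ncard : ℝ) / N ≤ ((B k ∩ Set.Icc 1 N).ncard : ℝ) / N :=
      div_le_div_of_nonneg_right (Nat.cast_le.2 (ncard_inter_Icc_mono (hAB k) N)) hN'.le
    have h4 : ((B k ∩ Set.Icc 1 N).ncard : ℝ) / N ≤ ((A ∩ Set.Icc 1 N).ncard : ℝ) / N + ε k := by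
      rw [div_add' _ _ _ hN'.ne', mul_comm (ε k)]
      exact div_le_div_of_nonneg_right (h k N) hN'.le
    constructor <;> linarith [h1.1, h1.2]
  refine ⟨M, fun N hN => ?_⟩
  rw [Real.dist_eq, abs_lt]
  have h1 := key N hN
  have h2 := key M le_rfl
  constructor <;> linarith [h1.1, h1.2, h2.1, h2.2]

theorem gen_pos {Q p : ℕ} (hp : p.Prime) : 0 < gen Q p := by
  have hp1 : 0 < p - 1 := Nat.sub_pos_of_lt hp.one_lt
  exact Nat.mul_pos hp.pos (Nat.div_pos (Nat.gcd_le_left _ hp1) (Nat.gcd_pos_of_pos_left _ hp1))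

theorem subset_avoid_map_gen {Q : ℕ} {A : Set ℕ}
    (hA : ∀ n, n ∈ A ↔ 0 < n ∧ ∀ p, p.Prime → ¬ p ∣ Q → ¬ gen Q p ∣ n) {l : List ℕ}
    (hl : ∀ p ∈ l, p.Prime ∧ ¬ p ∣ Q) : A ⊆ avoid (l.map (gen Q)) := by
  intro n hn
  obtain ⟨h0, h1⟩ := (hA n).1 hn
  refine ⟨h0, fun d hd => ?_⟩
  obtain ⟨p, hp, rfl⟩ := List.mem_map.1 hd
  exact h1 p (hl p hp).1 (hl p hp).2

theorem map_gen_pos {Q : ℕ} {l : List ℕ} (hl : ∀ p ∈ l, p.Prime ∧ ¬ p ∣ Q) :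
    ∀ e ∈ l.map (gen Q), 0 < e := fun e he => by
  obtain ⟨p, hp, rfl⟩ := List.mem_map.1 he
  exact gen_pos (hl p hp).1

theorem exists_hasDensity_of_gen {Q : ℕ} {A : Set ℕ} (hQ : 0 < Q) (hQ2 : 2 ∣ Q)
    (hA : ∀ n, n ∈ A ↔ 0 < n ∧ ∀ p, p.Prime → ¬ p ∣ Q → ¬ gen Q p ∣ n) :
    ∃ δ, HasDensity A δ := by
  classical
  set l : ℕ → List ℕ := fun k =>
    (List.range (2 * (k + 2))).filter fun p => p.Prime ∧ ¬ p ∣ Q with hl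
  have hlp : ∀ k, ∀ p ∈ l k, p.Prime ∧ ¬ p ∣ Q := fun k p hp => by
    simpa using (List.mem_filter.1 hp).2
  choose β hβ using fun k => exists_hasDensity_avoid _ (map_gen_pos (hlp k))
  refine exists_hasDensity_of_approx (fun k => avoid ((l k).map (gen Q))) β
    (fun k => Q / (4 * (((k + 2 : ℕ) : ℝ) - 1))) hβ (fun k => subset_avoid_map_gen hA (hlp k))
    (fun k N => ?_) ?_
  · have h := ncard_avoid_le (J := k + 2) (L := (l k).map (gen Q)) hQ hQ2 hA (by omega)
      (fun _ => false) (fun j hj hp hpQ h => ?_) N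
    · simpa using h
    · refine (h _ (List.mem_map.2 ⟨2 * j + 1, List.mem_filter.2 ⟨?_, ?_⟩, rfl⟩) dvd_rfl).elim
      · exact List.mem_range.2 (by omega)
      · simpa using ⟨hp, hpQ⟩
  · refine Filter.Tendsto.const_div_atTop (Filter.Tendsto.const_mul_atTop (by norm_num) ?_) _
    refine Filter.tendsto_atTop_mono (fun k => ?_) tendsto_natCast_atTop_atTop
    push_cast
    linarith

/-- A necessary condition for `p` to be a prime not dividing `Q` whose `gen Q p` is not a multiple
of an element of `L`, where `F` has only prime factors below `256`. -/
def uncovered (Q F : ℕ) (L : List ℕ) (p : ℕ) : Bool :=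
  (bif Nat.ble 256 p then Nat.beq (Nat.gcd p F) 1
    else [3, 5, 7, 11, 13].all fun q => !Nat.beq (p % q) 0 || Nat.beq p q) &&
    !Nat.beq (Q % p) 0 && L.all fun e => !Nat.beq (gen Q p % e) 0

/-- An upper bound for `10 ^ 12` times the sum of the reciprocals of `gen Q (2 * i + 1)` over the
uncovered `2 * i + 1` with `j ≤ i < j + 2 ^ k`. -/
def uncoveredSum (Q F : ℕ) (L : List ℕ) : ℕ → ℕ → ℕ
  | 0, j => bif uncovered Q F L (2 * j + 1) then 10 ^ 12 / gen Q (2 * j + 1) + 1 else 0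
  | k + 1, j => uncoveredSum Q F L k j + uncoveredSum Q F L k (j + 2 ^ k)

theorem not_beq_zero_of_not_dvd {a b : ℕ} (h : ¬ a ∣ b) : (!Nat.beq (b % a) 0) = true := by
  rw [Bool.not_eq_true', Bool.eq_false_iff, Ne, Nat.beq_eq]
  exact fun h0 => h (Nat.dvd_of_mod_eq_zero h0)

theorem uncovered_of_prime {Q F p : ℕ} {L : List ℕ} (hF : F ∣ Nat.factorial 255) (hp : p.Prime)
    (hpQ : ¬ p ∣ Q) (hL : ∀ e ∈ L, ¬ e ∣ gen Q p) : uncovered Q F L p = true := by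
  have h1 : ∀ q, q ≠ 1 → (!Nat.beq (p % q) 0 || Nat.beq p q) = true := fun q hq => by
    by_cases hd : q ∣ p
    · simp [((Nat.dvd_prime hp).1 hd).resolve_left hq]
    · simp only [not_beq_zero_of_not_dvd hd, Bool.true_or]
  have h2 : 256 ≤ p → Nat.gcd p F = 1 := fun h =>
    (hp.coprime_iff_not_dvd.2 fun hd =>
      absurd ((hp.dvd_factorial).1 (hd.trans hF)) (by omega) : Nat.Coprime p F)
  have h3 : (L.all fun e => !Nat.beq (gen Q p % e) 0) = true :=
    List.all_eq_true.2 fun e he => not_beq_zero_of_not_dvd (hL e he)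
  rw [uncovered, h3, not_beq_zero_of_not_dvd hpQ]
  by_cases h : 256 ≤ p
  · simp [h2 h, Nat.ble_eq_true_of_le h]
  · have h4 : Nat.ble 256 p = false := by
      rw [Bool.eq_false_iff, Ne, Nat.ble_eq]
      exact h
    simp only [h4, cond_false, List.all_cons, List.all_nil, h1, ne_eq, OfNat.ofNat_ne_one,
      not_false_eq_true, Bool.and_self]

theorem sum_le_uncoveredSum (Q F : ℕ) (L : List ℕ) (k j : ℕ) :
    10 ^ 12 * ∑ i ∈ Finset.range (2 ^ k), (if uncovered Q F L (2 * (j + i) + 1) then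
      (1 : ℝ) / gen Q (2 * (j + i) + 1) else 0) ≤ uncoveredSum Q F L k j := by
  induction k generalizing j with
  | zero =>
    simp only [pow_zero, Finset.range_one, Finset.sum_singleton, add_zero, uncoveredSum,
      Bool.cond_eq_ite]
    split
    · rcases Nat.eq_zero_or_pos (gen Q (2 * j + 1)) with h0 | h0
      · simp [h0]
      · rw [mul_one_div, div_le_iff₀ (by exact_mod_cast h0)]
        exact_mod_cast (Nat.lt_mul_of_div_lt (Nat.lt_succ_self (10 ^ 12 / gen Q (2 * j + 1))) h0).le
    · simp
  | succ k ih =>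
    rw [pow_succ 2 k, mul_two, Finset.sum_range_add, mul_add, uncoveredSum, Nat.cast_add]
    refine add_le_add (ih j) ?_
    simpa only [add_assoc] using ih (j + 2 ^ k)

theorem exists_hasDensity_Nset {Q : ℕ} (hQ : 0 < Q) (hQ2 : 2 ∣ Q)
    (H : ∀ p, p.Prime → p ∣ Q → p - 1 ∣ Q ∧ p ∣ Q / p + 1) {l : List ℕ}
    (hl : ∀ p ∈ l, p.Prime ∧ ¬ p ∣ Q) {F : ℕ} (hF : F ∣ Nat.factorial 255) {k : ℕ} (hk : k ≠ 0)
    {n w a b : ℕ}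
    (ha : a + uncoveredSum Q F (l.map (gen Q)) k 0 ≤ avoidBound false n (l.map (gen Q)) w)
    (hb : avoidBound true n (l.map (gen Q)) w ≤ b) :
    ∃ δ, HasDensity (Nset Q) δ ∧ a / 10 ^ 12 - Q / (4 * (2 ^ k - 1)) ≤ δ ∧ δ ≤ b / 10 ^ 12 := by
  have hA := fun n => mem_Nset_iff (n := n) hQ H
  obtain ⟨δ, hδ⟩ := exists_hasDensity_of_gen hQ hQ2 hA
  obtain ⟨α, hα⟩ := exists_hasDensity_avoid _ (map_gen_pos hl)
  obtain ⟨h1, h2⟩ := avoidBound_spec n _ (map_gen_pos hl) w hα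
  have h3 := hδ.mono hα (subset_avoid_map_gen hA hl)
  have hJ : 2 ≤ 2 ^ k := by
    calc 2 = 2 ^ 1 := rfl
      _ ≤ 2 ^ k := Nat.pow_le_pow_right two_pos (Nat.one_le_iff_ne_zero.2 hk)
  have h4 := hδ.sub_le hα (ncard_avoid_le hQ hQ2 hA hJ
    (fun j => uncovered Q F (l.map (gen Q)) (2 * j + 1))
    fun j _ hp hpQ h => uncovered_of_prime hF hp hpQ h)
  have h5 := sum_le_uncoveredSum Q F (l.map (gen Q)) k 0
  simp only [zero_add] at h5
  push_cast at h4
  rify at ha hb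
  refine ⟨δ, hδ, ?_, ?_⟩
  · rw [sub_le_iff_le_add, div_le_iff₀ (by norm_num)]
    linarith
  · rw [le_div_iff₀ (by norm_num)]
    linarith

/-- The product of the primes below `256`. -/
def smallPrimeProduct : ℕ :=
  64266330917908644872330635228106713310880186591609208114244758680898150367880703152525200743234420230

theorem smallPrimeProduct_dvd_factorial : smallPrimeProduct ∣ Nat.factorial 255 := by
  refine Nat.dvd_of_mod_eq_zero ?_
  decide +kernel

/-- Primes not dividing `2` with the smallest primitive values of `gen 2`. -/
def primes_2 : List ℕ :=
  [317, 311, 293, 269, 263, 257, 251, 239, 233, 227, 197, 191, 179, 173, 167, 149, 137, 131, 113,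
    107, 89, 83, 71, 59, 53, 47, 29, 23, 17, 11, 5, 3]

theorem density_bounds_two :
    ∃ δ : ℝ, HasDensity (Nset 2) δ ∧ 0.583874 < δ ∧ δ < 0.584604 := by
  have H : ∀ p, p.Prime → p ∣ 2 → p - 1 ∣ 2 ∧ p ∣ 2 / p + 1 := by
    intro p hp hd
    obtain rfl := (Nat.prime_dvd_prime_iff_eq hp Nat.prime_two).1 hd
    norm_num
  have hl : ∀ p ∈ primes_2, p.Prime ∧ ¬ p ∣ 2 := by
    simp only [primes_2, List.forall_mem_cons]
    norm_num
  have ha : 583935042617 + uncoveredSum 2 smallPrimeProduct (primes_2.map (gen 2)) 13 0 ≤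
      avoidBound false 33 (primes_2.map (gen 2)) 1000000 := by
    decide +kernel
  have hb : avoidBound true 33 (primes_2.map (gen 2)) 1000000 ≤ 584603999999 := by
    decide +kernel
  obtain ⟨δ, hδ, h1, h2⟩ := exists_hasDensity_Nset (by norm_num) (by norm_num) H hl
    smallPrimeProduct_dvd_factorial (by norm_num) ha hb
  clear ha hb
  norm_num at h1 h2
  exact ⟨δ, hδ, by linarith, by linarith⟩

/-- Primes not dividing `6` with the smallest primitive values of `gen 6`. -/
def primes_6 : List ℕ :=
  [199, 193, 107, 163, 89, 151, 83, 139, 109, 103, 59, 97, 47, 79, 73, 67, 23, 37, 31, 17, 19,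
    11, 13, 5, 7]

theorem density_bounds_six :
    ∃ δ : ℝ, HasDensity (Nset 6) δ ∧ 0.70405 < δ ∧ δ < 0.707659 := by
  have H : ∀ p, p.Prime → p ∣ 6 → p - 1 ∣ 6 ∧ p ∣ 6 / p + 1 := by
    intro p hp hd
    rw [show 6 = 2 * 3 by norm_num] at hd
    simp only [hp.dvd_mul] at hd
    have h : p = 2 ∨ p = 3 := by
      simpa only [Nat.prime_dvd_prime_iff_eq hp (by norm_num : Nat.Prime 2),
        Nat.prime_dvd_prime_iff_eq hp (by norm_num : Nat.Prime 3),
        or_assoc] using hd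
    rcases h with rfl | rfl <;> norm_num
  have hl : ∀ p ∈ primes_6, p.Prime ∧ ¬ p ∣ 6 := by
    simp only [primes_6, List.forall_mem_cons]
    norm_num
  have ha : 704233127833 + uncoveredSum 6 smallPrimeProduct (primes_6.map (gen 6)) 13 0 ≤
      avoidBound false 26 (primes_6.map (gen 6)) 100000 := by
    decide +kernel
  have hb : avoidBound true 26 (primes_6.map (gen 6)) 100000 ≤ 707658999999 := by
    decide +kernel
  obtain ⟨δ, hδ, h1, h2⟩ := exists_hasDensity_Nset (by norm_num) (by norm_num) H hl
    smallPrimeProduct_dvd_factorial (by norm_num) ha hb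
  clear ha hb
  norm_num at h1 h2
  exact ⟨δ, hδ, by linarith, by linarith⟩

/-- Primes not dividing `42` with the smallest primitive values of `gen 42`. -/
def primes_42 : List ℕ :=
  [59, 97, 47, 211, 79, 113, 73, 67, 127, 71, 23, 37, 31, 17, 29, 19, 11, 43, 13, 5]

theorem density_bounds_fortyTwo :
    ∃ δ : ℝ, HasDensity (Nset 42) δ ∧ 0.78215 < δ ∧ δ < 0.79399 := by
  have H : ∀ p, p.Prime → p ∣ 42 → p - 1 ∣ 42 ∧ p ∣ 42 / p + 1 := by
    intro p hp hd
    rw [show 42 = 2 * 3 * 7 by norm_num] at hd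
    simp only [hp.dvd_mul] at hd
    have h : p = 2 ∨ p = 3 ∨ p = 7 := by
      simpa only [Nat.prime_dvd_prime_iff_eq hp (by norm_num : Nat.Prime 2),
        Nat.prime_dvd_prime_iff_eq hp (by norm_num : Nat.Prime 3), Nat.prime_dvd_prime_iff_eq hp (by norm_num : Nat.Prime 7),
        or_assoc] using hd
    rcases h with rfl | rfl | rfl <;> norm_num
  have hl : ∀ p ∈ primes_42, p.Prime ∧ ¬ p ∣ 42 := by
    simp only [primes_42, List.forall_mem_cons]
    norm_num
  have ha : 783431894772 + uncoveredSum 42 smallPrimeProduct (primes_42.map (gen 42)) 13 0 ≤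
      avoidBound false 21 (primes_42.map (gen 42)) 100000 := by
    decide +kernel
  have hb : avoidBound true 21 (primes_42.map (gen 42)) 100000 ≤ 793989999999 := by
    decide +kernel
  obtain ⟨δ, hδ, h1, h2⟩ := exists_hasDensity_Nset (by norm_num) (by norm_num) H hl
    smallPrimeProduct_dvd_factorial (by norm_num) ha hb
  clear ha hb
  norm_num at h1 h2
  exact ⟨δ, hδ, by linarith, by linarith⟩

/-- Primes not dividing `1806` with the smallest primitive values of `gen 1806`. -/
def primes_1806 : List ℕ :=
  [59, 97, 47, 211, 79, 113, 73, 67, 127, 71, 173, 23, 37, 31, 17, 29, 19, 11, 13, 5]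

theorem density_bounds_1806 :
    ∃ δ : ℝ, HasDensity (Nset 1806) δ ∧ 0.7747 < δ ∧ δ < 0.812570 := by
  have H : ∀ p, p.Prime → p ∣ 1806 → p - 1 ∣ 1806 ∧ p ∣ 1806 / p + 1 := by
    intro p hp hd
    rw [show 1806 = 2 * 3 * 7 * 43 by norm_num] at hd
    simp only [hp.dvd_mul] at hd
    have h : p = 2 ∨ p = 3 ∨ p = 7 ∨ p = 43 := by
      simpa only [Nat.prime_dvd_prime_iff_eq hp (by norm_num : Nat.Prime 2),
        Nat.prime_dvd_prime_iff_eq hp (by norm_num : Nat.Prime 3), Nat.prime_dvd_prime_iff_eq hp (by norm_num : Nat.Prime 7), Nat.prime_dvd_prime_iff_eq hp (by norm_num : Nat.Prime 43),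
        or_assoc] using hd
    rcases h with rfl | rfl | rfl | rfl <;> norm_num
  have hl : ∀ p ∈ primes_1806, p.Prime ∧ ¬ p ∣ 1806 := by
    simp only [primes_1806, List.forall_mem_cons]
    norm_num
  have ha : 788479107038 + uncoveredSum 1806 smallPrimeProduct (primes_1806.map (gen 1806)) 15 0 ≤
      avoidBound false 21 (primes_1806.map (gen 1806)) 10000 := by
    decide +kernel
  have hb : avoidBound true 21 (primes_1806.map (gen 1806)) 10000 ≤ 812569999999 := by
    decide +kernel
  obtain ⟨δ, hδ, h1, h2⟩ := exists_hasDensity_Nset (by norm_num) (by norm_num) H hl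
    smallPrimeProduct_dvd_factorial (by norm_num) ha hb
  clear ha hb
  norm_num at h1 h2
  exact ⟨δ, hδ, by linarith, by linarith⟩

theorem density_bounds_2_6_42_1806 :
    (∃ δ : ℝ, HasDensity (Nset 2) δ ∧ 0.583874 < δ ∧ δ < 0.584604) ∧
    (∃ δ : ℝ, HasDensity (Nset 6) δ ∧ 0.70405 < δ ∧ δ < 0.707659) ∧
    (∃ δ : ℝ, HasDensity (Nset 42) δ ∧ 0.78215 < δ ∧ δ < 0.79399) ∧
    (∃ δ : ℝ, HasDensity (Nset 1806) δ ∧ 0.7747 < δ ∧ δ < 0.812570) :=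
  ⟨density_bounds_two, density_bounds_six, density_bounds_fortyTwo, density_bounds_1806⟩
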